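/- (Theorem 3.1, part (ii).) Let τ : ℤ³ → ℂ be nowhere zero, with arguments written τ(p̄,t̄,u), and let z̄, w̄ ∈ ℂ. For each (p̄,t̄) define difference operators on functions f : ℤ → ℂ by (M̄^{(z̄)}_{p̄,t̄} f)(u) = −z̄·f(u) + [τ(p̄,t̄,u−1)τ(p̄,t̄+1,u+1)/(τ(p̄,t̄+1,u)τ(p̄,t̄,u))]·f(u−1) and (M̄^{(w̄)}_{p̄,t̄} f)(u) = −w̄·f(u) + [τ(p̄,t̄,u−1)τ(p̄+1,t̄,u+1)/(τ(p̄+1,t̄,u)τ(p̄,t̄,u))]·f(u−1). Then the discrete Zakharov–Shabat equation M̄^{(w̄)}_{p̄,t̄+1} ∘ M̄^{(z̄)}_{p̄,t̄} = M̄^{(z̄)}_{p̄+1,t̄} ∘ M̄^{(w̄)}_{p̄,t̄} holds for all p̄, t̄ ∈ ℤ (as operators on all f : ℤ → ℂ) if and only if there exists a function H₂ : ℤ² → ℂ (independent of u) such that for all p̄, t̄, u ∈ ℤ: z̄·τ(p̄+1,t̄,u+1)τ(p̄,t̄+1,u) − w̄·τ(p̄,t̄+1,u+1)τ(p̄+1,t̄,u)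 + H₂(p̄,t̄)·τ(p̄+1,t̄+1,u+1)τ(p̄,t̄,u) = 0. -/

import Mathlib

noncomputable section

/-- The barred M-operator `M̄^{(z̄)}_{p̄,t̄}` of the `t̄`-flow:
`(M̄^{(z̄)}_{p̄,t̄} f)(u) = −z̄ f(u) + [τ(p̄,t̄,u−1)τ(p̄,t̄+1,u+1)/(τ(p̄,t̄+1,u)τ(p̄,t̄,u))] f(u−1)`. -/
noncomputable def MbarZ (τ : ℤ → ℤ → ℤ → ℂ) (zb : ℂ) (p t : ℤ) : (ℤ → ℂ) → (ℤ → ℂ) :=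
  fun f u => -zb * f u +
    (τ p t (u - 1) * τ p (t + 1) (u + 1) / (τ p (t + 1) u * τ p t u)) * f (u - 1)

/-- The barred M-operator `M̄^{(w̄)}_{p̄,t̄}` of the `p̄`-flow:
`(M̄^{(w̄)}_{p̄,t̄} f)(u) = −w̄ f(u) + [τ(p̄,t̄,u−1)τ(p̄+1,t̄,u+1)/(τ(p̄+1,t̄,u)τ(p̄,t̄,u))] f(u−1)`. -/
noncomputable def MbarW (τ : ℤ → ℤ → ℤ → ℂ) (wb : ℂ) (p t : ℤ) : (ℤ → ℂ) → (ℤ → ℂ) :=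
  fun f u => -wb * f u +
    (τ p t (u - 1) * τ (p + 1) t (u + 1) / (τ (p + 1) t u * τ p t u)) * f (u - 1)

/-- The negative of the coefficient `H₂` that the bilinear relation at `(p, t, u)` forces. -/
def bilinearQuotient (τ : ℤ → ℤ → ℤ → ℂ) (zb wb : ℂ) (p t u : ℤ) : ℂ :=
  (zb * (τ (p + 1) t (u + 1) * τ p (t + 1) u) - wb * (τ p (t + 1) (u + 1) * τ (p + 1) t u)) /
    (τ (p + 1) (t + 1) (u + 1) * τ p t u)

/-- The commutator of the two compositions is a multiple of the backward shift, with coefficient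
proportional to the backward difference of `bilinearQuotient`. -/
theorem MbarW_MbarZ_sub_MbarZ_MbarW (τ : ℤ → ℤ → ℤ → ℂ) (hτ : ∀ p t u : ℤ, τ p t u ≠ 0)
    (zb wb : ℂ) (p t u : ℤ) (f : ℤ → ℂ) :
    MbarW τ wb p (t + 1) (MbarZ τ zb p t f) u - MbarZ τ zb (p + 1) t (MbarW τ wb p t f) u =
      τ p t (u - 1) * τ (p + 1) (t + 1) (u + 1) / (τ p (t + 1) u * τ (p + 1) t u) *
        (bilinearQuotient τ zb wb p t u - bilinearQuotient τ zb wb p t (u - 1)) * f (u - 1) := by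
  have h0 := hτ p t u
  have h1 := hτ p t (u - 1)
  have h2 := hτ p (t + 1) u
  have h3 := hτ p (t + 1) (u - 1)
  have h4 := hτ (p + 1) t u
  have h5 := hτ (p + 1) t (u - 1)
  have h6 := hτ (p + 1) (t + 1) u
  have h7 := hτ (p + 1) (t + 1) (u + 1)
  simp only [MbarW, MbarZ, bilinearQuotient, sub_add_cancel]
  field_simp
  ring

/-- The discrete Zakharov–Shabat equation at `(p, t)` says that `bilinearQuotient` does not
depend on `u`. -/
theorem MbarW_comp_MbarZ_eq_iff (τ : ℤ → ℤ → ℤ → ℂ) (hτ : ∀ p t u : ℤ, τ p t u ≠ 0)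
    (zb wb : ℂ) (p t : ℤ) :
    MbarW τ wb p (t + 1) ∘ MbarZ τ zb p t = MbarZ τ zb (p + 1) t ∘ MbarW τ wb p t ↔
      ∀ u, bilinearQuotient τ zb wb p t u = bilinearQuotient τ zb wb p t (u - 1) := by
  constructor
  · intro h u
    have hu := MbarW_MbarZ_sub_MbarZ_MbarW τ hτ zb wb p t u 1
    have hcomp := congrFun (congrFun h 1) u
    simp only [Function.comp_apply] at hcomp
    rw [hcomp, sub_self] at hu
    simpa [hτ, sub_eq_zero] using hu.symm
  · intro h
    funext f u
    rw [← sub_eq_zero]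
    simp only [Function.comp_apply]
    rw [MbarW_MbarZ_sub_MbarZ_MbarW τ hτ, h u]
    simp

/-- `bilinearQuotient` solves the bilinear relation for the coefficient of the last term. -/
theorem bilinear_relation_iff (τ : ℤ → ℤ → ℤ → ℂ) (hτ : ∀ p t u : ℤ, τ p t u ≠ 0)
    (zb wb : ℂ) (p t u : ℤ) (H : ℂ) :
    zb * (τ (p + 1) t (u + 1) * τ p (t + 1) u) - wb * (τ p (t + 1) (u + 1) * τ (p + 1) t u) +
        H * (τ (p + 1) (t + 1) (u + 1) * τ p t u) = 0 ↔
      bilinearQuotient τ zb wb p t u = -H := by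
  rw [bilinearQuotient, div_eq_iff (mul_ne_zero (hτ _ _ _) (hτ _ _ _)), add_eq_zero_iff_eq_neg,
    neg_mul]

/-- Theorem 3.1, part (ii): the discrete Zakharov–Shabat equation
`M̄^{(w̄)}_{p̄,t̄+1} ∘ M̄^{(z̄)}_{p̄,t̄} = M̄^{(z̄)}_{p̄+1,t̄} ∘ M̄^{(w̄)}_{p̄,t̄}` holds for all
`p̄, t̄` iff there is `H₂(p̄,t̄)` (independent of `u`) with
`z̄ τ(p̄+1,t̄,u+1) τ(p̄,t̄+1,u) − w̄ τ(p̄,t̄+1,u+1) τ(p̄+1,t̄,u)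
  + H₂(p̄,t̄) τ(p̄+1,t̄+1,u+1) τ(p̄,t̄,u) = 0`. -/
theorem discrete_zakharov_shabat_ii (τ : ℤ → ℤ → ℤ → ℂ)
    (hτ : ∀ p t u : ℤ, τ p t u ≠ 0) (zb wb : ℂ) :
    (∀ p t : ℤ, MbarW τ wb p (t + 1) ∘ MbarZ τ zb p t = MbarZ τ zb (p + 1) t ∘ MbarW τ wb p t) ↔
      ∃ H₂ : ℤ → ℤ → ℂ, ∀ p t u : ℤ,
        zb * (τ (p + 1) t (u + 1) * τ p (t + 1) u) -
          wb * (τ p (t + 1) (u + 1) * τ (p + 1) t u) +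
          H₂ p t * (τ (p + 1) (t + 1) (u + 1) * τ p t u) = 0 := by
  simp only [MbarW_comp_MbarZ_eq_iff τ hτ, bilinear_relation_iff τ hτ]
  constructor
  · intro h
    refine ⟨fun p t => -bilinearQuotient τ zb wb p t 0, fun p t u => ?_⟩
    rw [neg_neg]
    induction u using Int.induction_on with
    | zero => rfl
    | succ n ih => rw [h, add_sub_cancel_right, ih]
    | pred n ih => rw [← h, ih]
  · rintro ⟨H, h⟩ p t u
    rw [h, h]

end
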